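/- Every non-cyclic finite subgroup of SU(2) contains the element −I. -/

import Mathlib

open Matrix in
/-- Cayley–Hamilton for `2 × 2` matrices of determinant one. -/
lemma mul_self_eq_trace_smul_sub_one {R : Type*} [CommRing R] {A : Matrix (Fin 2) (Fin 2) R}
    (hA : A.det = 1) : A * A = A.trace • A - 1 := by
  rw [det_fin_two] at hA
  ext i j
  fin_cases i <;> fin_cases j <;> simp [mul_apply, trace_fin_two]
  · linear_combination -hA
  · ring
  · ring
  · linear_combination -hA

lemma one_add_pow_of_mul_self_eq_zero {R : Type*} [Ring R] {N : R} (hN : N * N = 0) (n : ℕ) :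
    (1 + N) ^ n = 1 + n • N := by
  induction n with
  | zero => simp
  | succ n ih =>
    rw [pow_succ, ih, succ_nsmul]
    simp only [mul_add, add_mul, one_mul, mul_one, smul_mul_assoc, hN, smul_zero]
    abel

/-- A `2 × 2` matrix of finite order and determinant one that fixes a nonzero vector is trivial. -/
lemma eq_one_of_det_eq_one_of_mulVec_eq {K : Type*} [Field K] [CharZero K]
    {A : Matrix (Fin 2) (Fin 2) K} (hA : A.det = 1) {n : ℕ} (hn : n ≠ 0) (hAn : A ^ n = 1)
    {v : Fin 2 → K} (hv : v ≠ 0) (hAv : A.mulVec v = v) : A = 1 := by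
  have hdet : (A - 1).det = 0 :=
    Matrix.exists_mulVec_eq_zero_iff.mp ⟨v, hv, by simp [Matrix.sub_mulVec, hAv]⟩
  have htr : A.trace = 2 := by
    rw [Matrix.det_fin_two] at hA hdet
    simp at hdet
    rw [Matrix.trace_fin_two]
    linear_combination hA - hdet
  have hsq : (A - 1) * (A - 1) = 0 := by
    have h := mul_self_eq_trace_smul_sub_one hA
    rw [htr, two_smul] at h
    simp only [mul_sub, sub_mul, h, mul_one, one_mul]
    abel
  have h := one_add_pow_of_mul_self_eq_zero hsq n
  rw [add_sub_cancel, hAn, left_eq_add, ← Nat.cast_smul_eq_nsmul K, smul_eq_zero] at h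
  exact sub_eq_zero.mp (h.resolve_left (Nat.cast_ne_zero.mpr hn))

/-- The only matrix of order two and determinant one is `-1`. -/
lemma eq_neg_one_of_mul_self_eq_one {K : Type*} [Field K] [CharZero K]
    {A : Matrix (Fin 2) (Fin 2) K} (hA : A.det = 1) (hsq : A * A = 1) (h1 : A ≠ 1) : A = -1 := by
  have h := mul_self_eq_trace_smul_sub_one hA
  rw [hsq, eq_sub_iff_add_eq] at h
  have ht : A.trace ≠ 0 := by
    intro ht
    rw [ht, zero_smul] at h
    have := congrFun (congrFun h 0) 0
    norm_num at this
  have hs : A = (A.trace⁻¹ * 2) • (1 : Matrix (Fin 2) (Fin 2) K) := by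
    rw [mul_smul, two_smul, h, smul_smul, inv_mul_cancel₀ ht, one_smul]
  generalize A.trace⁻¹ * 2 = c at hs
  have hc : c = 1 ∨ c = -1 := by
    rw [hs] at hA
    simpa [Matrix.det_fin_two] using hA
  rcases hc with rfl | rfl
  · simp [hs] at h1
  · simpa using hs

/-- An endomorphism of a plane which is not a homothety has only lines as eigenspaces, so the
eigenvectors of such an endomorphism are eigenvectors of its whole centralizer. -/
lemma exists_forall_commute_eigenvector {K V : Type*} [Field K] [IsAlgClosed K] [AddCommGroup V]
    [Module K V] (hV : Module.finrank K V = 2) {X : Module.End K V}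
    (hX : X ∉ Submodule.span K {(1 : Module.End K V)}) :
    ∃ v : V, v ≠ 0 ∧ ∀ Y : Module.End K V, Commute Y X → ∃ c : K, Y v = c • v := by
  have : FiniteDimensional K V := Module.finite_of_finrank_eq_succ hV
  have : Nontrivial V := Module.nontrivial_of_finrank_eq_succ hV
  obtain ⟨μ, hμ⟩ := Module.End.exists_eigenvalue X
  obtain ⟨v, hv⟩ := hμ.exists_hasEigenvector
  refine ⟨v, hv.2, fun Y hY => ?_⟩
  have hlt : Module.finrank K (X.eigenspace μ) < 2 := by
    rw [← hV]
    refine Submodule.finrank_lt fun htop => hX (Submodule.mem_span_singleton.mpr ⟨μ, ?_⟩)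
    ext w
    have : w ∈ X.eigenspace μ := htop ▸ Submodule.mem_top
    simpa using (Module.End.mem_eigenspace_iff.mp this).symm
  have hle : Module.finrank K (X.eigenspace μ) ≤ 1 := by omega
  have hYv : Y v ∈ X.eigenspace μ := by
    rw [Module.End.mem_eigenspace_iff, ← Module.End.mul_apply, ← hY.eq, Module.End.mul_apply,
      hv.apply_eq_smul, map_smul]
  obtain ⟨⟨w, hw⟩, hspan⟩ := finrank_le_one_iff.mp hle
  obtain ⟨a, ha⟩ := hspan ⟨v, hv.1⟩
  obtain ⟨b, hb⟩ := hspan ⟨Y v, hYv⟩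
  rw [Subtype.ext_iff] at ha hb
  simp only [Submodule.coe_smul] at ha hb
  have ha0 : a ≠ 0 := by
    rintro rfl
    exact hv.2 (by simpa using ha.symm)
  exact ⟨b * a⁻¹, by rw [← ha, smul_smul, inv_mul_cancel_right₀ ha0, ha, hb]⟩

/-- A finite group of odd order with a faithful representation of determinant one on the plane is
cyclic: as `χ(g²) = χ(g)² - 2`, the representation has `⟨χ, χ⟩ ≥ 2`, so it is reducible. -/
lemma isCyclic_of_odd_card_of_det_eq_one {G : Type*} [Group G] [Finite G]
    (hodd : Odd (Nat.card G)) (φ : G →* Matrix (Fin 2) (Fin 2) ℂ)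
    (hφ : Function.Injective φ) (hdet : ∀ g, (φ g).det = 1) : IsCyclic G := by
  classical
  have := Fintype.ofFinite G
  have hcard : (Nat.card G : ℂ) ≠ 0 := Nat.cast_ne_zero.mpr Nat.card_pos.ne'
  have : Invertible (Nat.card G : ℂ) := invertibleOfNonzero hcard
  let ρ : Representation ℂ G (Fin 2 → ℂ) :=
    (Matrix.toLinAlgEquiv' : Matrix (Fin 2) (Fin 2) ℂ ≃ₐ[ℂ] _).toAlgHom.toMonoidHom.comp φ
  have hρ (g : G) : ρ g = Matrix.toLin' (φ g) := rfl
  have hchar (g : G) : ρ.character g = (φ g).trace := by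
    rw [Representation.character, hρ, Matrix.trace_toLin'_eq]
  have hinv (g : G) : (φ g⁻¹).trace = (φ g).trace := by
    have h : φ g⁻¹ = (φ g).adjugate := by
      have h1 : φ g⁻¹ * φ g = 1 := by rw [← map_mul, inv_mul_cancel, map_one]
      have h2 : φ g * (φ g).adjugate = 1 := by rw [Matrix.mul_adjugate, hdet, one_smul]
      exact left_inv_eq_right_inv h1 h2
    rw [h, Matrix.adjugate_fin_two, Matrix.trace_fin_two, Matrix.trace_fin_two]
    simp [add_comm]
  have hsq (g : G) : (φ (g ^ 2)).trace = (φ g).trace * (φ g).trace - 2 := by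
    rw [pow_two, map_mul, mul_self_eq_trace_smul_sub_one (hdet g)]
    simp
  have hsum : ∑ g : G, (φ g).trace = ∑ g : G, (φ g).trace * (φ g).trace - Nat.card G * 2 := by
    rw [← (Nat.Coprime.pow_left_bijective hodd.coprime_two_right).sum_comp
      (fun g => (φ g).trace)]
    simp only [hsq, Finset.sum_sub_distrib]
    simp [Nat.card_eq_fintype_card]
  have hfin : Module.finrank ℂ ρ.invariants + 2 =
      Module.finrank ℂ (Representation.linHom ρ ρ).invariants := by
    have h1 := Representation.card_inv_mul_sum_char_eq_finrank ρ
    have h2 := Representation.card_inv_mul_sum_char_eq_finrank (Representation.linHom ρ ρ)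
    simp only [Representation.char_linHom, hchar, hinv] at h1 h2
    rw [hsum, mul_sub, h2, inv_mul_cancel_left₀ hcard] at h1
    have h3 := eq_add_of_sub_eq h1
    exact_mod_cast h3.symm
  obtain ⟨X, hXinv, hX⟩ : ∃ X ∈ (Representation.linHom ρ ρ).invariants,
      X ∉ Submodule.span ℂ {(1 : Module.End ℂ (Fin 2 → ℂ))} := by
    by_contra! hle
    have h := (Submodule.finrank_mono (R := ℂ) hle).trans_eq (finrank_span_singleton one_ne_zero)
    omega
  obtain ⟨v, hv, hvX⟩ := exists_forall_commute_eigenvector (by simp) hX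
  have hcomm (g : G) : Commute (ρ g) X := by
    have h := (Representation.mem_invariants _ X).mp hXinv g
    rw [Representation.linHom_apply] at h
    change ρ g * X = X * ρ g
    nth_rewrite 2 [← h]
    rw [← Module.End.mul_eq_comp, ← Module.End.mul_eq_comp, mul_assoc, mul_assoc, ← map_mul,
      inv_mul_cancel, map_one, mul_one]
  choose c hc using fun g => hvX (ρ g) (hcomm g)
  let χ : G →* ℂ :=
    { toFun := c
      map_one' := smul_left_injective ℂ hv (by simp [← hc])
      map_mul' := fun g h => smul_left_injective ℂ hv (by
        simp only [← hc, map_mul, Module.End.mul_apply]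
        rw [hc h, map_smul, hc g, smul_smul, mul_comm]) }
  refine isCyclic_of_injective_ringHom χ ((injective_iff_map_eq_one χ).mpr fun g hg => hφ ?_)
  rw [map_one]
  refine eq_one_of_det_eq_one_of_mulVec_eq (hdet g) (orderOf_pos g).ne'
    (by rw [← map_pow, pow_orderOf_eq_one, map_one]) hv ?_
  have h : c g = 1 := hg
  rw [← Matrix.toLin'_apply, ← hρ, hc, h, one_smul]


/-- Every non-cyclic finite subgroup of `SU(2)` contains `-I`.  (Here a subgroup
of `SU(2)` is formalized as a subgroup `H` of `GL₂(ℂ)` all of whose elements lie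
in `Matrix.specialUnitaryGroup (Fin 2) ℂ`, i.e. are unitary of determinant 1.) -/
theorem stmt9 (H : Subgroup (Matrix.GeneralLinearGroup (Fin 2) ℂ))
    (hSU : ∀ g ∈ H, (g : Matrix (Fin 2) (Fin 2) ℂ) ∈ Matrix.specialUnitaryGroup (Fin 2) ℂ)
    (hfin : Finite H) (hnc : ¬ IsCyclic H) :
    ∃ g ∈ H, (g : Matrix (Fin 2) (Fin 2) ℂ) = -1 := by
  have hdet (g : H) : (g.1 : Matrix (Fin 2) (Fin 2) ℂ).det = 1 :=
    (Matrix.mem_specialUnitaryGroup_iff.mp (hSU g g.2)).2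
  let φ : H →* Matrix (Fin 2) (Fin 2) ℂ := (Units.coeHom _).comp H.subtype
  have hφ : Function.Injective φ := Units.val_injective.comp H.subtype_injective
  rcases Nat.even_or_odd (Nat.card H) with heven | hodd
  · obtain ⟨g, hg⟩ := exists_prime_orderOf_dvd_card' 2 heven.two_dvd
    refine ⟨g, g.2, eq_neg_one_of_mul_self_eq_one (hdet g) ?_ fun h1 => ?_⟩
    · have h := congrArg φ (pow_orderOf_eq_one g)
      rwa [hg, pow_two, map_mul, map_one] at h
    · have h : g = 1 := hφ (h1.trans (map_one φ).symm)
      simp [h] at hg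
  · exact absurd (isCyclic_of_odd_card_of_det_eq_one hodd φ hφ hdet) hnc
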